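/- arXiv:1006.5105 — 5 statements merged into one kernel-verified Lean document; each statement's English description precedes it below -/
import Mathlib

section
/- Let N be a positive integer, let p be a prime dividing N, and set v = val_p(N). Let M be the 4×4 integer matrix with (1,4)- and (2,3)-entries equal to 1, (3,2)- and (4,1)-entries equal to −1, and all other entries 0 (so M ∈ Sp(4, ℤ)). Then there exists γ ∈ Sp(4, ℤ) such that γ ≡ M (mod p^v) entrywise and γ ≡ 1₄ (mod N p^{−v}) entrywise. -/
open Matrix

/-- The standard symplectic matrix `J = [[0, 1₂], [−1₂, 0]]` in 2×2 block form. -/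
def Jmat : Matrix (Fin 4) (Fin 4) ℤ :=
  !![0, 0, 1, 0;
     0, 0, 0, 1;
     -1, 0, 0, 0;
     0, -1, 0, 0]

/-- The matrix `M` with (1,4)- and (2,3)-entries 1, (3,2)- and (4,1)-entries −1,
and all other entries 0. -/
def Mmat : Matrix (Fin 4) (Fin 4) ℤ :=
  !![0, 0, 0, 1;
     0, 0, 1, 0;
     0, -1, 0, 0;
     -1, 0, 0, 0]

/-- The product of the elementary symplectic matrices with off-diagonal blocks `e • w`,
`-e • w`, `e • w`, where `w = [[0, 1], [1, 0]]`. It is `1` at `e = 0` and `Mmat` at `e = 1`. -/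
def atkinLehnerGamma (e : ℤ) : Matrix (Fin 4) (Fin 4) ℤ :=
  !![1 - e ^ 2, 0, 0, 2 * e - e ^ 3;
     0, 1 - e ^ 2, 2 * e - e ^ 3, 0;
     0, -e, 1 - e ^ 2, 0;
     -e, 0, 0, 1 - e ^ 2]

theorem atkinLehnerGamma_symplectic (e : ℤ) :
    (atkinLehnerGamma e)ᵀ * Jmat * atkinLehnerGamma e = Jmat := by
  ext i j
  fin_cases i <;> fin_cases j <;>
    simp [atkinLehnerGamma, Jmat, Matrix.mul_apply, Fin.sum_univ_four] <;> ring

theorem sub_dvd_atkinLehnerGamma_sub (e f : ℤ) (i j : Fin 4) :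
    e - f ∣ atkinLehnerGamma e i j - atkinLehnerGamma f i j := by
  have hid : e - f ∣ (1 - e ^ 2) - (1 - f ^ 2) := ⟨-(e + f), by ring⟩
  have hoff : e - f ∣ (2 * e - e ^ 3) - (2 * f - f ^ 3) :=
    ⟨2 - (e ^ 2 + e * f + f ^ 2), by ring⟩
  have hneg : e - f ∣ -e - -f := ⟨-1, by ring⟩
  fin_cases i <;> fin_cases j <;>
    first
    | exact hid
    | exact hoff
    | exact hneg
    | exact ⟨0, by simp [atkinLehnerGamma]⟩

theorem atkinLehnerGamma_zero : atkinLehnerGamma 0 = 1 := by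
  ext i j
  fin_cases i <;> fin_cases j <;> simp [atkinLehnerGamma]

theorem atkinLehnerGamma_one : atkinLehnerGamma 1 = Mmat := by
  ext i j
  fin_cases i <;> fin_cases j <;> simp [atkinLehnerGamma, Mmat]

/-- Let `N` be a positive integer, `p` a prime dividing `N`, and `v = val_p(N)`. Then
there exists `γ ∈ Sp(4, ℤ)` with `γ ≡ M (mod p^v)` and `γ ≡ 1₄ (mod N p^{−v})`
entrywise. -/
theorem exists_atkin_lehner_gamma (N p : ℕ) (hN : 0 < N) (hp : p.Prime) (hpN : p ∣ N) :
    ∃ γ : Matrix (Fin 4) (Fin 4) ℤ,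
      γᵀ * Jmat * γ = Jmat ∧
      (∀ i j : Fin 4, ((p : ℤ) ^ (N.factorization p)) ∣ (γ i j - Mmat i j)) ∧
      (∀ i j : Fin 4, ((N / p ^ (N.factorization p) : ℕ) : ℤ) ∣
        (γ i j - (1 : Matrix (Fin 4) (Fin 4) ℤ) i j)) := by
  have hcop : IsCoprime ((p : ℤ) ^ N.factorization p)
      ((N / p ^ N.factorization p : ℕ) : ℤ) := by
    exact_mod_cast Nat.isCoprime_iff_coprime.mpr
      ((Nat.coprime_ordCompl hp hN.ne').pow_left (N.factorization p))
  obtain ⟨a, b, hab⟩ := hcop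
  set m : ℤ := ((N / p ^ N.factorization p : ℕ) : ℤ)
  refine ⟨atkinLehnerGamma (b * m), atkinLehnerGamma_symplectic _, fun i j => ?_, fun i j => ?_⟩
  · rw [← atkinLehnerGamma_one]
    exact Dvd.dvd.trans ⟨-a, by linear_combination hab⟩ (sub_dvd_atkinLehnerGamma_sub _ _ i j)
  · rw [← atkinLehnerGamma_zero]
    exact Dvd.dvd.trans ⟨b, by ring⟩ (sub_dvd_atkinLehnerGamma_sub _ _ i j)
end

section
/- Let F be a field and let g₁, g₂ ∈ GL(2, F). Then g₁ x g₂* = x for all x ∈ M₂(F) if and only if there exists z ∈ Fˣ such that g₁ = z·1₂ and g₂ = z⁻¹·1₂. In other words, the kernel of the homomorphism ρ : GL(2, F) × GL(2, F) → GL(M₂(F)) given by ρ(g₁, g₂)x = g₁ x g₂* is {(z·1₂, z⁻¹·1₂) : z ∈ Fˣ}, which is the image of the embedding of Fˣ in the exact sequence 1 → Fˣ → GL(2, F) × GL(2, F) → GSO(X) → 1 for X = M₂(F). -/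
open Matrix

/-- Let `F` be a field and `g₁, g₂ ∈ GL(2, F)`. Then `g₁ x g₂* = x` for all
`x ∈ M₂(F)` iff there is `z ∈ Fˣ` with `g₁ = z·1₂` and `g₂ = z⁻¹·1₂`: the kernel of
`ρ : GL(2, F) × GL(2, F) → GL(M₂(F))`, `ρ(g₁, g₂)x = g₁ x g₂*`, is
`{(z·1₂, z⁻¹·1₂) : z ∈ Fˣ}`, the image of `Fˣ` in the exact sequence
`1 → Fˣ → GL(2, F) × GL(2, F) → GSO(X) → 1` for `X = M₂(F)`. -/
theorem kernel_rho_split (F : Type*) [Field F]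
    (g₁ g₂ : Matrix (Fin 2) (Fin 2) F) (h₁ : IsUnit g₁.det) (h₂ : IsUnit g₂.det) :
    (∀ x : Matrix (Fin 2) (Fin 2) F, g₁ * x * g₂.adjugate = x) ↔
      ∃ z : Fˣ, g₁ = (z : F) • (1 : Matrix (Fin 2) (Fin 2) F) ∧
        g₂ = ((z⁻¹ : Fˣ) : F) • (1 : Matrix (Fin 2) (Fin 2) F) := by
  constructor
  · intro h
    have hone : g₁ * g₂.adjugate = 1 := by simpa using h 1
    have hcomm : ∀ x, x * g₁ = g₁ * x := fun x => by
      calc x * g₁ = g₁ * x * g₂.adjugate * g₁ := by rw [h x]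
        _ = g₁ * x := by rw [mul_assoc, mul_eq_one_comm.mp hone, mul_one]
    obtain ⟨z, rfl⟩ := Matrix.mem_range_scalar_iff_commute_single'.mpr
      fun i j => hcomm (Matrix.single i j 1)
    have hz : z ≠ 0 := by
      rintro rfl
      simp at h₁
    have hadj : g₂.adjugate = z⁻¹ • (1 : Matrix (Fin 2) (Fin 2) F) := by
      rw [← hone, Matrix.scalar_apply, ← Matrix.smul_one_eq_diagonal, smul_mul_assoc, one_mul,
        smul_smul, inv_mul_cancel₀ hz, one_smul]
    refine ⟨Units.mk0 z hz, by simp [Matrix.smul_one_eq_diagonal], ?_⟩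
    have hadj₂ := congrArg Matrix.adjugate hadj
    rw [Matrix.adjugate_adjugate _ (by simp)] at hadj₂
    simpa [Matrix.adjugate_smul] using hadj₂
  · rintro ⟨z, rfl, rfl⟩ x
    simp [Matrix.adjugate_smul, smul_smul]
end

section
/- Let F be a field of characteristic not 2, E a quadratic field extension of F, and σ the nontrivial F-algebra automorphism of E (so σ² = id and the fixed field of σ is F). Let X₀ = {x ∈ M₂(E) : σ(x) = x*}, where σ is applied entrywise and A* is the adjugate. Suppose t ∈ Fˣ and g ∈ GL(2, E) satisfy t⁻¹ g x σ(g)* = x for all x ∈ X₀. Then there exists z ∈ Eˣ such that g = z·1₂ and t = z·σ(z). (This identifies the kernel of ρ₀ in the exact sequence 1 → Eˣ → Fˣ × GL(2, E) → GSO(X₀) → 1, where Eˣ is embedded by z ↦ (N^E_F(z), z).) -/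
open Matrix

/-- Let `F` be a field of characteristic not 2, `E` a quadratic field extension of `F`,
and `σ` the nontrivial `F`-algebra automorphism of `E` (so `σ² = id` with fixed field
`F`). Let `X₀ = {x ∈ M₂(E) : σ(x) = x*}`. If `t ∈ Fˣ` and `g ∈ GL(2, E)` satisfy
`t⁻¹ g x σ(g)* = x` for all `x ∈ X₀`, then there exists `z ∈ Eˣ` with `g = z·1₂` and
`t = z·σ(z)`. This identifies the kernel of `ρ₀` in the exact sequence
`1 → Eˣ → Fˣ × GL(2, E) → GSO(X₀) → 1`, with `Eˣ` embedded by `z ↦ (N^E_F(z), z)`. -/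
theorem kernel_rho0_nonsplit (F E : Type*) [Field F] [Field E] [Algebra F E]
    (hchar : (2 : F) ≠ 0) (hrank : Module.finrank F E = 2)
    (σ : E ≃ₐ[F] E) (hσ2 : ∀ x : E, σ (σ x) = x) (hσne : ∃ x : E, σ x ≠ x)
    (hfix : ∀ x : E, σ x = x → ∃ a : F, algebraMap F E a = x)
    (t : Fˣ) (g : Matrix (Fin 2) (Fin 2) E) (hg : IsUnit g.det)
    (h : ∀ x : Matrix (Fin 2) (Fin 2) E, x.map σ = x.adjugate →
      (algebraMap F E (t : F))⁻¹ • (g * x * (g.map σ).adjugate) = x) :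
    ∃ z : Eˣ, g = (z : E) • (1 : Matrix (Fin 2) (Fin 2) E) ∧
      algebraMap F E (t : F) = (z : E) * σ (z : E) := by
  have ht : algebraMap F E (t : F) ≠ 0 := by simp
  have hmul : ∀ x : Matrix (Fin 2) (Fin 2) E, x.map σ = x.adjugate →
      g * x * (g.map σ).adjugate = algebraMap F E (t : F) • x := fun x hx ↦
    (inv_smul_eq_iff₀ ht).mp (h x hx)
  have hone : g * (g.map σ).adjugate = algebraMap F E (t : F) • 1 := by
    simpa using hmul 1 (by simp [Matrix.map_one])
  have hone' : (g.map σ).adjugate * g = algebraMap F E (t : F) • 1 := by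
    rw [← inv_smul_eq_iff₀ ht, ← Matrix.mul_smul] at hone
    rw [← inv_smul_eq_iff₀ ht, ← Matrix.smul_mul]
    exact mul_eq_one_comm.mp hone
  have hcomm : ∀ x : Matrix (Fin 2) (Fin 2) E, x.map σ = x.adjugate → g * x = x * g := by
    intro x hx
    have key := congrArg (· * g) (hmul x hx)
    simp only [Matrix.mul_assoc, hone', Matrix.smul_mul, Matrix.mul_smul, Matrix.mul_one] at key
    exact smul_right_injective _ ht key
  obtain ⟨e, he⟩ := hσne
  have hs : e - σ e ≠ 0 := sub_ne_zero.mpr (Ne.symm he)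
  have hdiag := hcomm !![e, 0; 0, σ e] (by
    ext i j; fin_cases i <;> fin_cases j <;> simp [Matrix.adjugate_fin_two, hσ2])
  have hupper := hcomm !![0, e - σ e; 0, 0] (by
    ext i j; fin_cases i <;> fin_cases j <;> simp [Matrix.adjugate_fin_two, hσ2])
  have h01 : g 0 1 = 0 := by
    have := congrFun (congrFun hdiag 0) 1
    simp [Matrix.mul_apply, Fin.sum_univ_two] at this
    exact (mul_eq_zero.mp (by linear_combination -this : (e - σ e) * g 0 1 = 0)).resolve_left hs
  have h10 : g 1 0 = 0 := by
    have := congrFun (congrFun hdiag 1) 0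
    simp [Matrix.mul_apply, Fin.sum_univ_two] at this
    exact (mul_eq_zero.mp (by linear_combination this : (e - σ e) * g 1 0 = 0)).resolve_left hs
  have h11 : g 1 1 = g 0 0 := by
    have := congrFun (congrFun hupper 0) 1
    simp [Matrix.mul_apply, Fin.sum_univ_two] at this
    exact mul_left_cancel₀ hs (by linear_combination -this)
  have hz : g 0 0 ≠ 0 := by
    intro h0
    simp [Matrix.det_fin_two, h0, h01] at hg
  refine ⟨Units.mk0 (g 0 0) hz, ?_, ?_⟩
  · ext i j
    fin_cases i <;> fin_cases j <;> simp [h01, h10, h11]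
  · have := congrFun (congrFun hone 0) 0
    simp [Matrix.mul_apply, Fin.sum_univ_two, Matrix.adjugate_fin_two, h01, h11] at this
    exact this.symm
end

section
/- Let F be a field of characteristic not 2, E a quadratic field extension of F, and σ the nontrivial F-algebra automorphism of E. Let X₀ = {x ∈ M₂(E) : σ(x) = x*}, where σ is applied entrywise and A* is the adjugate. Then X₀ is an F-linear subspace of M₂(E) (viewed as an F-vector space) of dimension 4 over F, and for every x ∈ X₀ the determinant det(x) lies in F; in particular x ↦ det(x) is an F-valued quadratic form on the 4-dimensional F-vector space X₀. -/
open Matrix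

/-- Entrywise form of the condition `σ(x) = x*`. -/
theorem map_eq_adjugate_fin_two_iff {R : Type*} [CommRing R] (σ : R → R)
    (x : Matrix (Fin 2) (Fin 2) R) :
    x.map σ = x.adjugate ↔
      σ (x 0 0) = x 1 1 ∧ σ (x 0 1) = -x 0 1 ∧ σ (x 1 0) = -x 1 0 ∧ σ (x 1 1) = x 0 0 := by
  rw [Matrix.adjugate_fin_two, ← Matrix.ext_iff]
  simp [Fin.forall_fin_two, and_assoc]

/-- An anti-invariant nonzero element spans the anti-invariants over the fixed field. -/
theorem exists_algebraMap_mul_of_map_eq_neg {F E : Type*} [Field F] [Field E] [Algebra F E]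
    (σ : E ≃ₐ[F] E) (hfix : ∀ x : E, σ x = x → ∃ a : F, algebraMap F E a = x)
    {δ x : E} (hδ : σ δ = -δ) (hδ0 : δ ≠ 0) (hx : σ x = -x) :
    ∃ a : F, algebraMap F E a * δ = x := by
  obtain ⟨a, ha⟩ := hfix (x / δ) (by rw [map_div₀, hx, hδ, neg_div_neg_eq])
  exact ⟨a, by rw [ha, div_mul_cancel₀ _ hδ0]⟩

/-- The `F`-basis `1, diag(δ, -δ), δ E₁₂, δ E₂₁` of `X₀`, for `δ` with `σ(δ) = -δ`. -/
def adjugateFixedBasis {E : Type*} [Field E] (δ : E) : Fin 4 → Matrix (Fin 2) (Fin 2) E :=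
  ![!![1, 0; 0, 1], !![δ, 0; 0, -δ], !![0, δ; 0, 0], !![0, 0; δ, 0]]

theorem sum_smul_adjugateFixedBasis {F E : Type*} [Field F] [Field E] [Algebra F E]
    (δ : E) (c : Fin 4 → F) :
    ∑ i, c i • adjugateFixedBasis δ i =
      !![algebraMap F E (c 0) + algebraMap F E (c 1) * δ, algebraMap F E (c 2) * δ;
        algebraMap F E (c 3) * δ, algebraMap F E (c 0) - algebraMap F E (c 1) * δ] := by
  ext i j
  fin_cases i <;> fin_cases j <;>
    simp [adjugateFixedBasis, Fin.sum_univ_four, Algebra.algebraMap_eq_smul_one, sub_eq_add_neg]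

/-- Let `F` be a field of characteristic not 2, `E` a quadratic field extension of `F`,
and `σ` the nontrivial `F`-algebra automorphism of `E`. Let
`X₀ = {x ∈ M₂(E) : σ(x) = x*}` (with `σ` applied entrywise and `A*` the adjugate).
Then `X₀` is an `F`-linear subspace of `M₂(E)` of dimension 4 over `F` (it is the span
of 4 linearly independent elements), and `det(x) ∈ F` for every `x ∈ X₀`, so that
`x ↦ det(x)` is an `F`-valued quadratic form on the 4-dimensional `F`-space `X₀`. -/
theorem X0_subspace_dim_four_det (F E : Type*) [Field F] [Field E] [Algebra F E]
    (hchar : (2 : F) ≠ 0) (hrank : Module.finrank F E = 2)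
    (σ : E ≃ₐ[F] E) (hσ2 : ∀ x : E, σ (σ x) = x) (hσne : ∃ x : E, σ x ≠ x)
    (hfix : ∀ x : E, σ x = x → ∃ a : F, algebraMap F E a = x) :
    (Matrix.map (0 : Matrix (Fin 2) (Fin 2) E) σ = (0 : Matrix (Fin 2) (Fin 2) E).adjugate) ∧
    (∀ x y : Matrix (Fin 2) (Fin 2) E,
      x.map σ = x.adjugate → y.map σ = y.adjugate → (x + y).map σ = (x + y).adjugate) ∧
    (∀ (a : F) (x : Matrix (Fin 2) (Fin 2) E),
      x.map σ = x.adjugate → (a • x).map σ = (a • x).adjugate) ∧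
    (∃ b : Fin 4 → Matrix (Fin 2) (Fin 2) E,
      LinearIndependent F b ∧ (∀ i, (b i).map σ = (b i).adjugate) ∧
      ∀ x : Matrix (Fin 2) (Fin 2) E,
        (x.map σ = x.adjugate ↔ x ∈ Submodule.span F (Set.range b))) ∧
    (∀ x : Matrix (Fin 2) (Fin 2) E,
      x.map σ = x.adjugate → ∃ a : F, algebraMap F E a = x.det) := by
  have h2 : (2 : E) ≠ 0 := by
    simpa only [map_ofNat] using (map_ne_zero (algebraMap F E)).2 hchar
  obtain ⟨u, hu⟩ := hσne
  obtain ⟨δ, hδ, hδ0⟩ : ∃ δ : E, σ δ = -δ ∧ δ ≠ 0 :=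
    ⟨u - σ u, by rw [map_sub, hσ2, neg_sub], sub_ne_zero.2 (Ne.symm hu)⟩
  have hmem (x : Matrix (Fin 2) (Fin 2) E) :
      x.map σ = x.adjugate ↔ x ∈ Submodule.span F (Set.range (adjugateFixedBasis δ)) := by
    rw [map_eq_adjugate_fin_two_iff, Submodule.mem_span_range_iff_exists_fun]
    simp only [sum_smul_adjugateFixedBasis]
    constructor
    · rintro ⟨h00, h01, h10, h11⟩
      obtain ⟨p, hp⟩ := hfix ((x 0 0 + x 1 1) / 2) (by
        rw [map_div₀, map_add, h00, h11, map_ofNat, add_comm])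
      obtain ⟨q, hq⟩ := exists_algebraMap_mul_of_map_eq_neg σ hfix hδ hδ0
        (x := (x 0 0 - x 1 1) / 2) (by
          rw [map_div₀, map_sub, h00, h11, map_ofNat, ← neg_div, neg_sub])
      obtain ⟨r, hr⟩ := exists_algebraMap_mul_of_map_eq_neg σ hfix hδ hδ0 h01
      obtain ⟨s, hs⟩ := exists_algebraMap_mul_of_map_eq_neg σ hfix hδ hδ0 h10
      refine ⟨![p, q, r, s], ?_⟩
      ext i j
      fin_cases i <;> fin_cases j <;> simp [hp, hq, hr, hs] <;> field_simp <;> ring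
    · rintro ⟨c, rfl⟩
      simp [hδ, sub_eq_add_neg]
  refine ⟨(hmem 0).2 (zero_mem _), fun x y hx hy => (hmem _).2 (add_mem ((hmem x).1 hx)
    ((hmem y).1 hy)), fun a x hx => (hmem _).2 (Submodule.smul_mem _ a ((hmem x).1 hx)),
    ⟨adjugateFixedBasis δ, ?_, fun i => (hmem _).2 (Submodule.subset_span ⟨i, rfl⟩), hmem⟩, ?_⟩
  · rw [Fintype.linearIndependent_iff]
    intro c hc
    rw [sum_smul_adjugateFixedBasis, ← Matrix.ext_iff] at hc
    simp only [Fin.forall_fin_two, Matrix.of_apply, Matrix.cons_val_zero, Matrix.cons_val_one,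
      Matrix.zero_apply, mul_eq_zero, hδ0, or_false, map_eq_zero] at hc
    obtain ⟨⟨h00, h2'⟩, h3, h11⟩ := hc
    have h0 : c 0 = 0 := by
      have : 2 * algebraMap F E (c 0) = 0 := by linear_combination h00 + h11
      simpa [h2] using this
    have h1 : c 1 = 0 := by
      simpa [h0, hδ0] using h00
    intro i
    fin_cases i <;> assumption
  · intro x hx
    obtain ⟨h00, h01, h10, h11⟩ := (map_eq_adjugate_fin_two_iff σ x).1 hx
    apply hfix
    rw [Matrix.det_fin_two, map_sub, map_mul, map_mul, h00, h01, h10, h11]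
    ring
end

section
/- Let G be a group, H ≤ G a subgroup of index 2, and g₀ ∈ G \ H. Let φ₀ : H → GL(2, ℂ) be a group homomorphism and η : G → ℂˣ a group homomorphism such that η(h) = det(φ₀(h)) for all h ∈ H. Define T : G → GL(4, ℂ) in 2×2 block form by T(x) = [[φ₀(x), 0], [0, φ₀(g₀ x g₀⁻¹)]] for x ∈ H, and T(x) = [[0, φ₀(x g₀⁻¹)], [φ₀(g₀ x), 0]] for x ∉ H. Let B be the 4×4 matrix in block form [[η(g₀)·ω, 0], [0, ω]], where ω = [[0,1],[−1,0]]. Then: (a) T is a group homomorphism, i.e. T(x x′) = T(x) T(x′) for all x, x′ ∈ G; and (b) T(x)ᵀ B T(x) = η(x) · B for all x ∈ G. In particular T takes values in the group of symplectic similitudes of the nondegenerate alternating form B, with similitude character η. -/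
open Matrix

/-- The 2×2 standard symplectic matrix `ω = [[0,1],[−1,0]]`. -/
def omegaMat : Matrix (Fin 2) (Fin 2) ℂ := !![0, 1; -1, 0]

/-- Every `2 × 2` matrix is a similitude of the standard symplectic form, with factor its
determinant. -/
lemma transpose_mul_omegaMat_mul (A : Matrix (Fin 2) (Fin 2) ℂ) :
    Aᵀ * omegaMat * A = A.det • omegaMat := by
  ext i j
  fin_cases i <;> fin_cases j <;>
    simp [omegaMat, Matrix.mul_apply, Fin.sum_univ_two, Matrix.det_fin_two] <;> ring

/-- Let `G` be a group, `H ≤ G` of index 2, `g₀ ∈ G \ H`, `φ₀ : H → GL(2, ℂ)` a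
homomorphism and `η : G → ℂˣ` a homomorphism with `η(h) = det(φ₀(h))` on `H`. Define
`T : G → GL(4, ℂ)` in 2×2 block form by `T(x) = [[φ₀(x), 0], [0, φ₀(g₀ x g₀⁻¹)]]`
for `x ∈ H` and `T(x) = [[0, φ₀(x g₀⁻¹)], [φ₀(g₀ x), 0]]` for `x ∉ H`, and let
`B = [[η(g₀)·ω, 0], [0, ω]]` with `ω = [[0,1],[−1,0]]`. Then (a) `T` is a group
homomorphism, and (b) `T(x)ᵀ B T(x) = η(x)·B` for all `x ∈ G`: `T` takes values in
the symplectic similitude group of `B` with similitude character `η`. -/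
theorem induced_representation_symplectic (G : Type*) [Group G]
    (H : Subgroup G) (hH : H.index = 2) (g₀ : G) (hg₀ : g₀ ∉ H)
    (φ₀ : H →* GL (Fin 2) ℂ) (η : G →* ℂˣ)
    (hη : ∀ h : H, ((η (h : G) : ℂˣ) : ℂ) = Matrix.det (φ₀ h : Matrix (Fin 2) (Fin 2) ℂ))
    (T : G → Matrix (Fin 2 ⊕ Fin 2) (Fin 2 ⊕ Fin 2) ℂ)
    (hTin : ∀ (x : G) (hx : x ∈ H) (hx' : g₀ * x * g₀⁻¹ ∈ H),
      T x = Matrix.fromBlocks (φ₀ ⟨x, hx⟩ : Matrix (Fin 2) (Fin 2) ℂ) 0 0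
        (φ₀ ⟨g₀ * x * g₀⁻¹, hx'⟩ : Matrix (Fin 2) (Fin 2) ℂ))
    (hTout : ∀ (x : G) (hx : x ∉ H) (h1 : x * g₀⁻¹ ∈ H) (h2 : g₀ * x ∈ H),
      T x = Matrix.fromBlocks 0 (φ₀ ⟨x * g₀⁻¹, h1⟩ : Matrix (Fin 2) (Fin 2) ℂ)
        (φ₀ ⟨g₀ * x, h2⟩ : Matrix (Fin 2) (Fin 2) ℂ) 0)
    (B : Matrix (Fin 2 ⊕ Fin 2) (Fin 2 ⊕ Fin 2) ℂ)
    (hB : B = Matrix.fromBlocks (((η g₀ : ℂˣ) : ℂ) • omegaMat) 0 0 omegaMat) :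
    (∀ x y : G, T (x * y) = T x * T y) ∧
    (∀ x : G, (T x)ᵀ * B * T x = ((η x : ℂˣ) : ℂ) • B) := by
  have mem_mul : ∀ {a b : G}, a * b ∈ H ↔ (a ∈ H ↔ b ∈ H) :=
    fun {a b} => Subgroup.mul_mem_iff_of_index_two hH
  have conj_mem : ∀ {x : G}, x ∈ H → g₀ * x * g₀⁻¹ ∈ H := fun {x} hx => by
    simp [mem_mul, hx, hg₀]
  have mul_inv_mem : ∀ {x : G}, x ∉ H → x * g₀⁻¹ ∈ H := fun {x} hx => by
    simp [mem_mul, hx, hg₀]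
  have mul_left_mem : ∀ {x : G}, x ∉ H → g₀ * x ∈ H := fun {x} hx => by
    simp [mem_mul, hx, hg₀]
  have T_of_mem := fun (x : G) (hx : x ∈ H) => hTin x hx (conj_mem hx)
  have T_of_notMem := fun (x : G) (hx : x ∉ H) =>
    hTout x hx (mul_inv_mem hx) (mul_left_mem hx)
  have coe_mul : ∀ {a b c : G} (ha : a ∈ H) (hb : b ∈ H) (hc : c ∈ H), a * b = c →
      (φ₀ ⟨a, ha⟩ : Matrix (Fin 2) (Fin 2) ℂ) * (φ₀ ⟨b, hb⟩ : Matrix (Fin 2) (Fin 2) ℂ) =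
        (φ₀ ⟨c, hc⟩ : Matrix (Fin 2) (Fin 2) ℂ) := by
    rintro a b _ ha hb hc rfl
    rw [← Units.val_mul, ← map_mul]
    rfl
  have similitude : ∀ h : H, (φ₀ h : Matrix (Fin 2) (Fin 2) ℂ)ᵀ * omegaMat *
      (φ₀ h : Matrix (Fin 2) (Fin 2) ℂ) = ((η (h : G) : ℂˣ) : ℂ) • omegaMat := fun h => by
    rw [transpose_mul_omegaMat_mul, hη]
  refine ⟨fun x y => ?_, fun x => ?_⟩
  · by_cases hx : x ∈ H <;> by_cases hy : y ∈ H
    · have hxy : x * y ∈ H := H.mul_mem hx hy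
      rw [T_of_mem x hx, T_of_mem y hy, T_of_mem _ hxy, Matrix.fromBlocks_multiply,
        coe_mul hx hy hxy rfl,
        coe_mul (conj_mem hx) (conj_mem hy) (conj_mem hxy) (by group)]
      simp
    · have hxy : x * y ∉ H := by simp [mem_mul, hx, hy]
      rw [T_of_mem x hx, T_of_notMem y hy, T_of_notMem _ hxy, Matrix.fromBlocks_multiply,
        coe_mul hx (mul_inv_mem hy) (mul_inv_mem hxy) (by group),
        coe_mul (conj_mem hx) (mul_left_mem hy) (mul_left_mem hxy) (by group)]
      simp
    · have hxy : x * y ∉ H := by simp [mem_mul, hx, hy]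
      rw [T_of_notMem x hx, T_of_mem y hy, T_of_notMem _ hxy, Matrix.fromBlocks_multiply,
        coe_mul (mul_inv_mem hx) (conj_mem hy) (mul_inv_mem hxy) (by group),
        coe_mul (mul_left_mem hx) hy (mul_left_mem hxy) (by group)]
      simp
    · have hxy : x * y ∈ H := by simp [mem_mul, hx, hy]
      rw [T_of_notMem x hx, T_of_notMem y hy, T_of_mem _ hxy, Matrix.fromBlocks_multiply,
        coe_mul (mul_inv_mem hx) (mul_left_mem hy) hxy (by group),
        coe_mul (mul_left_mem hx) (mul_inv_mem hy) (conj_mem hxy) (by group)]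
      simp
  · subst hB
    by_cases hx : x ∈ H
    · rw [T_of_mem x hx]
      simp [Matrix.fromBlocks_transpose, Matrix.fromBlocks_multiply, Matrix.fromBlocks_smul,
        similitude, smul_smul, mul_comm]
    · rw [T_of_notMem x hx]
      simp [Matrix.fromBlocks_transpose, Matrix.fromBlocks_multiply, Matrix.fromBlocks_smul,
        similitude, smul_smul, mul_comm]
      rw [mul_left_comm, mul_inv_cancel₀ (Units.ne_zero _), mul_one]
end
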